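/- Let G be a connected finite simple graph, let H be a subgraph of G, let v be a vertex of H that is universal in H (i.e., adjacent in H to every other vertex of H), with |V(H)| ≥ 2, and let H' := H − v. Then gon(G) ≥ M and gon(H) = M, where M := min over effective divisors D of H' of max({deg(D)} ∪ {deg(D) + |clump(H', D, w)| : w ∈ V(H'), D(w) = 0}). -/

import Mathlib

open SimpleGraph Finset
open scoped Classical

noncomputable section

def lap {V : Type} [Fintype V] (G : SimpleGraph V) (S : V → ℤ) : V → ℤ :=
  fun v => ∑ w : V, if G.Adj v w then S v - S w else 0

def Effective {V : Type} (D : V → ℤ) : Prop := ∀ v, 0 ≤ D v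

def degDiv {V : Type} [Fintype V] (D : V → ℤ) : ℤ := ∑ v, D v

def LinEquiv {V : Type} [Fintype V] (G : SimpleGraph V) (D D' : V → ℤ) : Prop :=
  ∃ S : V → ℤ, D' = D - lap G S

def PosRank {V : Type} [Fintype V] (G : SimpleGraph V) (D : V → ℤ) : Prop :=
  ∀ v : V, ∃ D' : V → ℤ, Effective D' ∧ LinEquiv G D D' ∧ 1 ≤ D' v

def gonality {V : Type} [Fintype V] (G : SimpleGraph V) : ℕ :=
  sInf {n : ℕ | ∃ D : V → ℤ, Effective D ∧ PosRank G D ∧ degDiv D = (n : ℤ)}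

def indic {V : Type} (A : Set V) : V → ℤ := fun v => if v ∈ A then 1 else 0

/-- The clump centred at `v`: the intersection of all sets `S` containing `v`
such that `D w ≥ |N(w) ∩ S|` for every vertex `w ∉ S`. -/
def clump {V : Type} (G : SimpleGraph V) (D : V → ℤ) (v : V) : Set V :=
  ⋂₀ {S : Set V | v ∈ S ∧ ∀ w ∉ S, ((G.neighborSet w ∩ S).ncard : ℤ) ≤ D w}

theorem lap_sub {V : Type} [Fintype V] (G : SimpleGraph V) (S T : V → ℤ) :
    lap G (S - T) = lap G S - lap G T := by
  funext u
  simp only [lap, Pi.sub_apply, ← Finset.sum_sub_distrib]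
  refine Finset.sum_congr rfl fun w _ => ?_
  split_ifs <;> ring

theorem lap_add {V : Type} [Fintype V] (G : SimpleGraph V) (S T : V → ℤ) :
    lap G (S + T) = lap G S + lap G T := by
  funext u
  simp only [lap, Pi.add_apply, ← Finset.sum_add_distrib]
  refine Finset.sum_congr rfl fun w _ => ?_
  split_ifs <;> ring

theorem lap_neg {V : Type} [Fintype V] (G : SimpleGraph V) (S : V → ℤ) :
    lap G (-S) = -lap G S := by
  funext u
  simp only [lap, Pi.neg_apply, ← Finset.sum_neg_distrib]
  refine Finset.sum_congr rfl fun w _ => ?_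
  split_ifs <;> ring

theorem degDiv_lap {V : Type} [Fintype V] (G : SimpleGraph V) (S : V → ℤ) :
    degDiv (lap G S) = 0 := by
  have h : degDiv (lap G S) = -degDiv (lap G S) := by
    unfold degDiv lap
    conv_lhs => rw [Finset.sum_comm]
    simp only [← Finset.sum_neg_distrib]
    refine Finset.sum_congr rfl fun u _ => Finset.sum_congr rfl fun w _ => ?_
    simp only [G.adj_comm w u]
    split_ifs <;> ring
  omega

theorem degDiv_sub_lap {V : Type} [Fintype V] (G : SimpleGraph V) (D S : V → ℤ) :
    degDiv (D - lap G S) = degDiv D := by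
  have h := degDiv_lap G S
  unfold degDiv at *
  simp only [Pi.sub_apply, Finset.sum_sub_distrib]
  omega

/-- On a connected graph the kernel of the Laplacian consists of constant functions. -/
theorem eq_of_lap_eq_zero {V : Type} [Fintype V] {G : SimpleGraph V} (hG : G.Connected)
    {T : V → ℤ} (hT : lap G T = 0) (a b : V) : T a = T b := by
  have : Nonempty V := ⟨a⟩
  obtain ⟨u, hu⟩ := Finite.exists_max T
  have key : ∀ w, T w = T u := by
    intro w
    obtain ⟨p⟩ := hG.preconnected w u
    induction p with
    | nil => rfl
    | @cons x y z hxy _ ih =>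
      have hy := ih hu
      have h0 : lap G T y = 0 := congrFun hT y
      have hx := (Finset.sum_eq_zero_iff_of_nonneg (fun w _ => by
        have := hu w
        split_ifs <;> omega)).1 h0 x (Finset.mem_univ _)
      rw [if_pos hxy.symm] at hx
      omega
  rw [key a, key b]

theorem ncard_le_lap {V : Type} [Fintype V] (G : SimpleGraph V) (T : V → ℤ) (u : V)
    (hu : ∀ w, T w ≤ T u) (B : Set V) (hB : ∀ w ∈ B, G.Adj u w ∧ T w < T u) :
    (B.ncard : ℤ) ≤ lap G T u := by
  have h : (B.ncard : ℤ) = ∑ w : V, if w ∈ B then 1 else 0 := by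
    rw [Finset.sum_boole, Set.ncard_eq_toFinset_card', Set.toFinset_card, Fintype.card_subtype]
  rw [h]
  refine Finset.sum_le_sum fun w _ => ?_
  have h1 := hu w
  have h2 := hB w
  split_ifs with h3 h4 h4
  · have := (h2 h3).2
    omega
  · exact absurd (h2 h3).1 h4
  · omega
  · exact le_rfl

theorem lap_indic_of_notMem {V : Type} [Fintype V] (G : SimpleGraph V) (A : Set V) {u : V}
    (hu : u ∉ A) : lap G (indic A) u = -((G.neighborSet u ∩ A).ncard : ℤ) := by
  have h : ((G.neighborSet u ∩ A).ncard : ℤ) =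
      ∑ w : V, if w ∈ G.neighborSet u ∩ A then 1 else 0 := by
    rw [Finset.sum_boole, Set.ncard_eq_toFinset_card', Set.toFinset_card, Fintype.card_subtype]
  rw [h, ← Finset.sum_neg_distrib]
  refine Finset.sum_congr rfl fun w _ => ?_
  simp only [indic, if_neg hu, Set.mem_inter_iff, SimpleGraph.mem_neighborSet]
  split_ifs <;> simp_all

theorem lap_indic_nonneg_of_mem {V : Type} [Fintype V] (G : SimpleGraph V) (A : Set V) {u : V}
    (hu : u ∈ A) : 0 ≤ lap G (indic A) u := by
  refine Finset.sum_nonneg fun w _ => ?_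
  simp only [indic, if_pos hu]
  split_ifs <;> norm_num

theorem one_le_lap_indic {V : Type} [Fintype V] (G : SimpleGraph V) (A : Set V) {u x : V}
    (hu : u ∈ A) (hx : x ∉ A) (hux : G.Adj u x) : 1 ≤ lap G (indic A) u := by
  have h := ncard_le_lap G (indic A) u (fun w => by
    simp only [indic, if_pos hu]
    split_ifs <;> norm_num) {x} (by
    rintro w rfl
    simp [indic, hu, hx, hux])
  simpa using h

/-- Firing the set where a legal firing script is maximal is legal. -/
theorem effective_sub_lap_indic_argmax {V : Type} [Fintype V] (G : SimpleGraph V)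
    {D T : V → ℤ} (hD : Effective D) (hT : Effective (D - lap G T)) :
    Effective (D - lap G (indic {u | ∀ w, T w ≤ T u})) := by
  intro u
  have hu := hT u
  have hDu := hD u
  simp only [Pi.sub_apply] at hu ⊢
  by_cases hmem : u ∈ {u | ∀ w, T w ≤ T u}
  · have : lap G (indic {u | ∀ w, T w ≤ T u}) u ≤ lap G T u := by
      refine Finset.sum_le_sum fun w _ => ?_
      have hw := hmem w
      have hw' : w ∉ {u | ∀ w, T w ≤ T u} → T w < T u := fun h => by
        by_contra hlt
        exact h fun z => (hmem z).trans (not_lt.1 hlt)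
      simp only [indic, if_pos hmem]
      split_ifs with h1 h2
      · omega
      · have := hw' h2
        omega
      · exact le_rfl
    omega
  · rw [lap_indic_of_notMem G _ hmem]
    omega

theorem finite_scripts {V : Type} [Fintype V] {G : SimpleGraph V} (hG : G.Connected)
    (D : V → ℤ) (v : V) : {S : V → ℤ | S v = 0 ∧ Effective (D - lap G S)}.Finite := by
  refine Set.Finite.of_finite_image (f := fun S => D - lap G S) ?_ ?_
  · refine (Set.finite_Icc (0 : V → ℤ) (fun _ => degDiv D)).subset ?_
    rintro _ ⟨S, ⟨-, hS⟩, rfl⟩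
    refine ⟨fun u => hS u, fun u => ?_⟩
    rw [← degDiv_sub_lap G D S]
    exact Finset.single_le_sum (fun w _ => hS w) (Finset.mem_univ u)
  · rintro S ⟨hS, -⟩ T ⟨hT, -⟩ hST
    have h0 : lap G (S - T) = 0 := by
      rw [lap_sub, sub_eq_zero]
      simpa using hST
    funext u
    have := eq_of_lap_eq_zero hG h0 u v
    simp only [Pi.sub_apply] at this
    omega

/-- Existence of reduced divisors, in the form: every legal firing script is maximal at `v`. -/
theorem exists_reduced {V : Type} [Fintype V] {G : SimpleGraph V} (hG : G.Connected)
    {D : V → ℤ} (hD : Effective D) (v : V) :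
    ∃ S : V → ℤ, Effective (D - lap G S) ∧
      ∀ T, Effective (D - lap G S - lap G T) → ∀ w, T w ≤ T v := by
  obtain ⟨S, ⟨hSv, hS⟩, hmax⟩ := Set.exists_max_image _ (fun S : V → ℤ => ∑ u, S u)
    (finite_scripts hG D v) ⟨0, rfl, by simpa [lap, Effective] using hD⟩
  refine ⟨S, hS, fun T hT => ?_⟩
  by_contra hv
  have hlegal := effective_sub_lap_indic_argmax G hS hT
  have hle := hmax (S + indic {u | ∀ w, T w ≤ T u})
    ⟨by simp only [Pi.add_apply, hSv, zero_add]; exact if_neg hv, by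
      rwa [lap_add, ← sub_sub]⟩
  have : Nonempty V := ⟨v⟩
  obtain ⟨u, hu⟩ := Finite.exists_max T
  have hpos : (0 : ℤ) < ∑ z, indic {u | ∀ w, T w ≤ T u} z := by
    refine Finset.sum_pos' (fun z _ => ?_) ⟨u, Finset.mem_univ u, ?_⟩
    · unfold indic
      split_ifs <;> norm_num
    · have h1 : indic {u | ∀ w, T w ≤ T u} u = 1 := if_pos hu
      omega
  simp only [Pi.add_apply, Finset.sum_add_distrib] at hle
  omega

theorem exists_gonality_divisor {V : Type} [Fintype V] (G : SimpleGraph V) :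
    ∃ D : V → ℤ, Effective D ∧ PosRank G D ∧ degDiv D = (gonality G : ℤ) := by
  refine Nat.sInf_mem (s := {n : ℕ | ∃ D : V → ℤ, Effective D ∧ PosRank G D ∧
    degDiv D = (n : ℤ)}) ⟨Fintype.card V, fun _ => 1, fun _ => zero_le_one, fun _ =>
      ⟨fun _ => 1, fun _ => zero_le_one, ⟨0, ?_⟩, le_rfl⟩, ?_⟩
  · funext u
    simp [lap]
  · simp [degDiv]

/-- The intersection defining a clump itself belongs to the family being intersected. -/
theorem ncard_neighborSet_inter_clump_le {W : Type} [Fintype W] (K : SimpleGraph W) (D : W → ℤ)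
    (w : W) {u : W} (hu : u ∉ clump K D w) :
    ((K.neighborSet u ∩ clump K D w).ncard : ℤ) ≤ D u := by
  simp only [clump, Set.mem_sInter, not_forall] at hu
  obtain ⟨S, hS, huS⟩ := hu
  have h1 : clump K D w ⊆ S := Set.sInter_subset_of_mem hS
  have h2 := Set.ncard_le_ncard (Set.inter_subset_inter_right (K.neighborSet u) h1)
    (Set.toFinite _)
  exact le_trans (by exact_mod_cast h2) (hS.2 u huS)

theorem mem_clump_self {W : Type} (K : SimpleGraph W) (D : W → ℤ) (w : W) : w ∈ clump K D w :=
  fun _ hS => hS.1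

theorem sInf_clump_le_gonality {V W : Type} [Fintype V] [Fintype W] {G : SimpleGraph V}
    (hG : G.Connected) (K : SimpleGraph W) (v : V) (f : W → V) (hf : Function.Injective f)
    (hadj : ∀ a b, K.Adj a b → G.Adj (f a) (f b)) (hv : ∀ a, G.Adj v (f a)) :
    sInf {m : ℕ | ∃ D : W → ℤ, Effective D ∧
      degDiv D + (((Finset.univ.filter (fun w => D w = 0)).sup
        (fun w => (clump K D w).ncard) : ℕ) : ℤ) = (m : ℤ)} ≤ gonality G := by
  obtain ⟨D₀, hD₀, hrank, hdeg⟩ := exists_gonality_divisor G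
  obtain ⟨S, hS, hred⟩ := exists_reduced hG hD₀ v
  set D := D₀ - lap G S with hD
  have hsup : (Finset.univ.filter (fun w => D (f w) = 0)).sup
      (fun w => (clump K (D ∘ f) w).ncard) ≤ (D v).toNat := by
    refine Finset.sup_le fun w hw => ?_
    rw [Finset.mem_filter] at hw
    obtain ⟨D', hD', ⟨S', hS'⟩, hone⟩ := hrank (f w)
    have hT : D' = D - lap G (S' - S) := by
      rw [lap_sub, hS', hD]
      abel
    set T := S' - S
    have hmax : ∀ z, T z ≤ T v := hred T (hT ▸ hD')
    have hfire : ∀ u, T u = T v → ∀ B : Set W, (∀ b ∈ B, G.Adj u (f b) ∧ T (f b) < T v) →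
        (B.ncard : ℤ) ≤ D u := by
      intro u hu B hB
      have h1 := ncard_le_lap G T u (fun z => hu ▸ hmax z) (f '' B) (by
        rintro _ ⟨b, hb, rfl⟩
        rw [hu]
        exact hB b hb)
      rw [Set.ncard_image_of_injective _ hf] at h1
      have h2 := hD' u
      rw [hT, Pi.sub_apply] at h2
      omega
    have hsub : clump K (D ∘ f) w ⊆ {a | T (f a) < T v} := by
      refine Set.sInter_subset_of_mem ⟨?_, fun u hu => ?_⟩
      · by_contra hlt
        have heq : T (f w) = T v := le_antisymm (hmax _) (not_lt.1 hlt)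
        have h1 := ncard_le_lap G T (f w) (fun z => heq ▸ hmax z) ∅ (by simp)
        rw [hT, Pi.sub_apply, hw.2] at hone
        simp only [Set.ncard_empty, Nat.cast_zero] at h1
        omega
      · refine hfire (f u) (le_antisymm (hmax _) (not_lt.1 hu)) _ ?_
        rintro b ⟨hb, hb'⟩
        exact ⟨hadj _ _ hb, hb'⟩
    have h1 := Set.ncard_le_ncard hsub (Set.toFinite _)
    have h2 := hfire v rfl {a | T (f a) < T v} fun b hb => ⟨hv b, hb⟩
    show (clump K (D ∘ f) w).ncard ≤ _
    omega
  have hsum : degDiv (D ∘ f) + D v ≤ gonality G := by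
    rw [← hdeg, ← degDiv_sub_lap G D₀ S, ← hD]
    have hnot : v ∉ Finset.univ.image f := by
      simp only [Finset.mem_image, Finset.mem_univ, true_and, not_exists]
      intro a ha
      exact (hv a).ne ha.symm
    have h1 : ∑ u ∈ insert v (Finset.univ.image f), D u ≤ degDiv D :=
      Finset.sum_le_sum_of_subset_of_nonneg (Finset.subset_univ _) fun u _ _ => hS u
    rw [Finset.sum_insert hnot, Finset.sum_image fun a _ b _ h => hf h] at h1
    simp only [degDiv, Function.comp_apply] at h1 ⊢
    omega
  have hDv := hS v
  have hpos : 0 ≤ degDiv (D ∘ f) := Finset.sum_nonneg fun a _ => hS (f a)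
  set c := (Finset.univ.filter (fun w => D (f w) = 0)).sup
      (fun w => (clump K (D ∘ f) w).ncard) with hc
  refine le_trans (Nat.sInf_le (m := (degDiv (D ∘ f)).toNat + c)
    ⟨D ∘ f, fun a => hS (f a), ?_⟩) ?_
  · simp only [Function.comp_apply]
    rw [← hc]
    push_cast
    rw [Int.toNat_of_nonneg hpos]
  · omega

theorem gonality_le_sInf_clump {V W : Type} [Fintype V] [Fintype W] [Nonempty W]
    (G : SimpleGraph V) (K : SimpleGraph W) (v : V) (f : W → V) (hf : Function.Injective f)
    (hadj : ∀ a b, G.Adj (f a) (f b) → K.Adj a b) (hv : ∀ a, G.Adj v (f a))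
    (hsurj : ∀ u, u ≠ v → ∃ a, f a = u) :
    gonality G ≤ sInf {m : ℕ | ∃ D : W → ℤ, Effective D ∧
      degDiv D + (((Finset.univ.filter (fun w => D w = 0)).sup
        (fun w => (clump K D w).ncard) : ℕ) : ℤ) = (m : ℤ)} := by
  have hne : {m : ℕ | ∃ D : W → ℤ, Effective D ∧
      degDiv D + (((Finset.univ.filter (fun w => D w = 0)).sup
        (fun w => (clump K D w).ncard) : ℕ) : ℤ) = (m : ℤ)}.Nonempty :=
    ⟨_, 0, fun _ => le_rfl, by
      rw [show degDiv (0 : W → ℤ) = 0 from Finset.sum_const_zero, zero_add]⟩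
  obtain ⟨D, hD, hdeg⟩ := Nat.sInf_mem hne
  refine Nat.sInf_le ?_
  rw [Set.mem_ofPred_eq, ← hdeg]
  set c := (Finset.univ.filter (fun w => D w = 0)).sup (fun w => (clump K D w).ncard) with hc
  have hvf : ¬∃ a, f a = v := fun ⟨a, ha⟩ => (hv a).ne ha.symm
  set E : V → ℤ := Function.extend f D fun _ => (c : ℤ) with hE
  have hEf : ∀ a, E (f a) = D a := fun a => hf.extend_apply D _ a
  have hEv : E v = c := Function.extend_apply' _ _ _ hvf
  have hEeff : Effective E := by
    intro u
    by_cases hu : u = v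
    · rw [hu, hEv]
      exact Int.natCast_nonneg c
    · obtain ⟨a, rfl⟩ := hsurj u hu
      rw [hEf]
      exact hD a
  have hfire : ∀ C : Set W, (C.ncard : ℤ) ≤ c →
      (∀ u ∉ C, ((K.neighborSet u ∩ C).ncard : ℤ) ≤ D u) →
      Effective (E - lap G (-indic (f '' C))) := by
    intro C hCc hC u
    rw [lap_neg, sub_neg_eq_add, Pi.add_apply]
    have hEu := hEeff u
    by_cases hu : u ∈ f '' C
    · have := lap_indic_nonneg_of_mem G _ hu
      omega
    · rw [lap_indic_of_notMem G _ hu]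
      by_cases huv : u = v
      · have h1 := Set.ncard_le_ncard (Set.inter_subset_right (s := G.neighborSet u)
          (t := f '' C)) (Set.toFinite _)
        rw [Set.ncard_image_of_injective _ hf] at h1
        rw [huv] at h1 ⊢
        rw [hEv]
        omega
      · obtain ⟨a, rfl⟩ := hsurj u huv
        have ha : a ∉ C := fun h => hu ⟨a, h, rfl⟩
        have hsub : G.neighborSet (f a) ∩ f '' C ⊆ f '' (K.neighborSet a ∩ C) := by
          rintro _ ⟨hz, b, hb, rfl⟩
          exact ⟨b, ⟨hadj _ _ hz, hb⟩, rfl⟩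
        have h1 := Set.ncard_le_ncard hsub (Set.toFinite _)
        rw [Set.ncard_image_of_injective _ hf] at h1
        have h2 := hC a ha
        rw [hEf]
        omega
  have hrefl : LinEquiv G E E := ⟨0, by funext u; simp [lap]⟩
  refine ⟨E, hEeff, fun u => ?_, ?_⟩
  · by_cases hu : 1 ≤ E u
    · exact ⟨E, hEeff, hrefl, hu⟩
    by_cases huv : u = v
    · subst huv
      have hpos : ∀ a, 1 ≤ D a := by
        intro a
        by_contra ha
        have ha0 : D a = 0 := le_antisymm (by omega) (hD a)
        have h1 : (clump K D a).ncard ≤ c :=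
          Finset.le_sup (f := fun w => (clump K D w).ncard) (by simp [ha0])
        have h2 : 0 < (clump K D a).ncard :=
          (Set.ncard_pos (Set.toFinite _)).2 ⟨a, mem_clump_self K D a⟩
        rw [hEv] at hu
        omega
      obtain ⟨a₀⟩ := ‹Nonempty W›
      refine ⟨E - lap G (-indic {u}), fun z => ?_, ⟨_, rfl⟩, ?_⟩
      all_goals rw [lap_neg, sub_neg_eq_add, Pi.add_apply]
      · by_cases hz : z = u
        · have h1 := lap_indic_nonneg_of_mem G {u} (u := z) hz
          have := hEeff z
          omega
        · rw [lap_indic_of_notMem G {u} hz]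
          have h1 := Set.ncard_le_ncard (Set.inter_subset_right (s := G.neighborSet z)
            (t := {u})) (Set.toFinite _)
          rw [Set.ncard_singleton] at h1
          obtain ⟨a, rfl⟩ := hsurj z hz
          have := hpos a
          rw [hEf]
          omega
      · have h1 := one_le_lap_indic G {u} (u := u) (x := f a₀) rfl (hv a₀).ne' (hv a₀)
        have := hEeff u
        omega
    · obtain ⟨a, rfl⟩ := hsurj u huv
      have ha0 : D a = 0 := le_antisymm (by rw [hEf] at hu; omega) (hD a)
      have h1 : (clump K D a).ncard ≤ c :=
        Finset.le_sup (f := fun w => (clump K D w).ncard) (by simp [ha0])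
      have hmem : f a ∈ f '' clump K D a := ⟨a, mem_clump_self K D a, rfl⟩
      refine ⟨_, hfire (clump K D a) (by exact_mod_cast h1)
        fun z hz => ncard_neighborSet_inter_clump_le K D a hz, ⟨_, rfl⟩, ?_⟩
      have h2 := one_le_lap_indic G (f '' clump K D a) hmem
        (fun ⟨b, _, hb⟩ => hvf ⟨b, hb⟩) (hv a).symm
      rw [lap_neg, sub_neg_eq_add, Pi.add_apply, hEf, ha0]
      omega
  · have huniv : (Finset.univ : Finset V) = insert v (Finset.univ.image f) := by
      ext u
      simp only [Finset.mem_univ, Finset.mem_insert, Finset.mem_image, true_and, true_iff]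
      exact or_iff_not_imp_left.2 (hsurj u)
    unfold degDiv
    rw [huniv, Finset.sum_insert (by simpa using hvf), Finset.sum_image fun a _ b _ h => hf h,
      hEv, add_comm]
    simp only [hEf]

/-- Let `G` be a connected graph, `H` a subgraph of `G`, `v` a universal vertex of `H`
with `|V(H)| ≥ 2`, and `H' := H - v`.  With
`M := min over effective divisors D of H' of
   max({deg D} ∪ {deg D + |clump(H', D, w)| : w ∈ V(H'), D w = 0})`,
we have `gon(G) ≥ M` and `gon(H) = M`.  (Here the inner maximum is expressed as
`deg D` plus the sup over `{w : D w = 0}` of the clump sizes, which agrees with it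
since clumps are nonempty and `sup ∅ = 0`.) -/
theorem stmt_5 {V : Type} [Fintype V] (G : SimpleGraph V) (hG : G.Connected)
    (H : G.Subgraph) (v : V) (hv : v ∈ H.verts)
    (huniv : ∀ w ∈ H.verts, w ≠ v → H.Adj v w)
    (hcard : 2 ≤ H.verts.ncard) :
    ∀ M : ℕ,
      M = sInf {m : ℕ | ∃ D : ↥(H.deleteVerts {v}).verts → ℤ, Effective D ∧
          degDiv D + (((Finset.univ.filter (fun w => D w = 0)).sup
            (fun w => (clump (H.deleteVerts {v}).coe D w).ncard) : ℕ) : ℤ) = (m : ℤ)} →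
      M ≤ gonality G ∧ gonality H.coe = M := by
  intro M hM
  have hmem : ∀ a : ↥(H.deleteVerts {v}).verts, (a : V) ∈ H.verts ∧ (a : V) ≠ v := fun a => by
    have h := a.2
    simpa [Subgraph.deleteVerts_verts] using h
  have hvadj : ∀ a : ↥(H.deleteVerts {v}).verts, H.Adj v a := fun a =>
    huniv a (hmem a).1 (hmem a).2
  have hK : ∀ a b : ↥(H.deleteVerts {v}).verts,
      (H.deleteVerts {v}).coe.Adj a b ↔ H.Adj (a : V) b := fun a b => by
    have ha := hmem a
    have hb := hmem b
    rw [Subgraph.coe_adj, Subgraph.deleteVerts_adj]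
    simp only [Set.mem_singleton_iff]
    tauto
  obtain ⟨w, hw, hwv⟩ := Set.exists_ne_of_one_lt_ncard hcard v
  have : Nonempty ↥(H.deleteVerts {v}).verts :=
    ⟨⟨w, by simpa [Subgraph.deleteVerts_verts] using ⟨hw, hwv⟩⟩⟩
  have hconn : H.coe.Connected := by
    have hreach : ∀ u : H.verts, H.coe.Reachable ⟨v, hv⟩ u := fun u => by
      by_cases h : (u : V) = v
      · obtain rfl : (⟨v, hv⟩ : H.verts) = u := Subtype.ext h.symm
        rfl
      · exact SimpleGraph.Adj.reachable (huniv u u.2 h)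
    exact (SimpleGraph.connected_iff_exists_forall_reachable _).2 ⟨⟨v, hv⟩, hreach⟩
  let f : ↥(H.deleteVerts {v}).verts → H.verts := fun a => ⟨a, (hmem a).1⟩
  have hf : Function.Injective f := fun a b h => Subtype.ext (congrArg (fun z : H.verts => (z : V)) h)
  subst hM
  refine ⟨sInf_clump_le_gonality hG _ v (fun a => (a : V)) Subtype.val_injective
    (fun a b h => ((hK a b).1 h).adj_sub) fun a => (hvadj a).adj_sub, le_antisymm ?_ ?_⟩
  · refine gonality_le_sInf_clump H.coe _ ⟨v, hv⟩ f hf (fun a b h => (hK a b).2 h) hvadj ?_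
    rintro ⟨u, hu⟩ huv
    have hne : u ≠ v := fun h => huv (Subtype.ext h)
    exact ⟨⟨u, by simpa [Subgraph.deleteVerts_verts] using ⟨hu, hne⟩⟩, rfl⟩
  · exact sInf_clump_le_gonality hconn _ ⟨v, hv⟩ f hf (fun a b h => (hK a b).1 h) hvadj
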